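/- Let n ≥ 2. Let P be the projection of W_n onto E([n]) ⊕ E(−[n]) — the sum of the eigenspaces of B_n for the eigenvalues [n] and −[n] — whose kernel is the sum of the eigenspaces of B_n for the eigenvalues [n−2k] with 0 < k < n (P is the action of the type D Jones–Wenzl projector d_n on V^{⊗n}). Then the sequence of powers R^m of the image R of the type D full twist converges to P as m → ∞, in the topology on the endomorphisms (equivalently, the matrices with respect to the standard basis) of W_n induced entrywise by the q-adic valuation topology of 𝕂. -/

import Mathlib

set_option synthInstance.maxHeartbeats 1000000
set_option maxHeartbeats 1000000

noncomputable section

/-- The field `𝕂 = ℚ((q))` of formal Laurent series, with its `q`-adic valuation topology. -/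
abbrev Kq : Type := LaurentSeries ℚ

/-- The variable `q ∈ 𝕂 = ℚ((q))`. -/
noncomputable def q : Kq := HahnSeries.single (1 : ℤ) (1 : ℚ)

/-- The quantum integer `[m] = (q^m - q^{-m})/(q - q⁻¹) ∈ 𝕂`, for `m : ℤ`. -/
noncomputable def qint (m : ℤ) : Kq := (q ^ m - q ^ (-m)) / (q - q⁻¹)

/-- `W n` is the `𝕂`-vector space of functions `(Fin n → Bool) → 𝕂`, with standard basis
indexed by the words of length `n` in the letters `x` (encoded `false`) and `y` (encoded
`true`); it models the tensor power `V^{⊗n}`. -/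
abbrev W (n : ℕ) : Type := (Fin n → Bool) → Kq

/-- `ε(x) = -1`, `ε(y) = 1`. -/
def eps (b : Bool) : ℤ := if b then 1 else -1

/-- The word `w` with its `i`-th letter flipped. -/
def flipLetter (n : ℕ) (w : Fin n → Bool) (i : Fin n) : Fin n → Bool :=
  Function.update w i (!(w i))

/-- The `𝕂`-linear endomorphism `B` of `W n = V^{⊗n}` given on basis vectors by
`B e_w = Σ_{i=0}^{n-1} (Π_{j=i+1}^{n-1} q^{ε(w_j)}) e_{w⁽ⁱ⁾}`. -/
noncomputable def Bop (n : ℕ) : Module.End Kq (W n) where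
  toFun f := fun u => ∑ i : Fin n,
    (∏ j ∈ Finset.univ.filter (fun j => i < j), q ^ eps (u j)) * f (flipLetter n u i)
  map_add' f g := by
    funext u
    simp only [Pi.add_apply, mul_add]
    rw [Finset.sum_add_distrib]
  map_smul' c f := by
    funext u
    simp only [Pi.smul_apply, smul_eq_mul, RingHom.id_apply]
    rw [Finset.mul_sum]
    exact Finset.sum_congr rfl fun i _ => by ring

/-- The type I Temperley–Lieb cup–cap operator acting on the letters in positions `p` and `p'`
of basis words by `(x,x) ↦ 0`, `(y,y) ↦ 0`, `(x,y) ↦ -q⁻¹(x,y) + (y,x)`,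
`(y,x) ↦ (x,y) - q(y,x)`. -/
noncomputable def uhatAt (n : ℕ) (p p' : Fin n) : Module.End Kq (W n) where
  toFun f := fun u =>
    if u p = u p' then 0
    else if u p = false then -(q⁻¹) * f u + f (u ∘ Equiv.swap p p')
    else f (u ∘ Equiv.swap p p') - q * f u
  map_add' f g := by
    funext u
    simp only [Pi.add_apply]
    split_ifs <;> ring
  map_smul' c f := by
    funext u
    simp only [Pi.smul_apply, smul_eq_mul, RingHom.id_apply]
    split_ifs <;> ring

/-- The operator `S₀` flipping the first letter: `S₀ e_w = e_{w⁽⁰⁾}`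
(the identity if `n = 0`). -/
noncomputable def S0 (n : ℕ) : Module.End Kq (W n) :=
  if h : 0 < n then
    { toFun := fun f u => f (flipLetter n u ⟨0, h⟩)
      map_add' := fun f g => rfl
      map_smul' := fun c f => rfl }
  else 1

/-- The type I cup–cap operator `Ûᵢ`: for `1 ≤ i ≤ n-1` it acts on the `i`-th and `(i+1)`-st
letters (`0`-based positions `i-1` and `i`), and `Û₀ := S₀Û₁S₀`; out-of-range indices
give `0`. -/
noncomputable def uhat (n : ℕ) (i : ℕ) : Module.End Kq (W n) :=
  if h : 1 ≤ i ∧ i < n then uhatAt n ⟨i - 1, by omega⟩ ⟨i, h.2⟩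
  else if h0 : i = 0 ∧ 2 ≤ n then S0 n * uhatAt n ⟨0, by omega⟩ ⟨1, by omega⟩ * S0 n
  else 0

/-- The image `R = ((1 + qÛ₀)(1 + qÛ₁)⋯(1 + qÛ_{n-1}))^{2(n-1)}` of the type `D` full twist
`δₙ = (σ₀'σ₁⋯σ_{n-1})^{2(n-1)}` acting on `W n = V^{⊗n}`. -/
noncomputable def fullTwist (n : ℕ) : Module.End Kq (W n) :=
  (((List.range n).map (fun i => (1 : Module.End Kq (W n)) + q • uhat n i)).prod) ^ (2 * (n - 1))

/-! ### Valuations of powers of `q` and of quantum integers -/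

/-- The `q`-adic valuation on `𝕂`. -/
abbrev val : Valuation Kq (WithZero (Multiplicative ℤ)) := Valued.v

lemma val_q : val q = WithZero.exp (-1 : ℤ) :=
  LaurentSeries.valuation_single_zpow ℚ 1

lemma val_q_lt_one : val q < 1 := by
  rw [val_q, ← WithZero.exp_zero, WithZero.exp_lt_exp]
  norm_num

lemma q_ne_zero : q ≠ 0 := by
  rw [← Valuation.ne_zero_iff val, val_q]
  exact WithZero.exp_ne_zero

lemma val_q_zpow_le_one {m : ℤ} (hm : 0 ≤ m) : val (q ^ m) ≤ 1 := by
  obtain ⟨k, rfl⟩ := Int.eq_ofNat_of_zero_le hm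
  rw [zpow_natCast, map_pow]
  exact pow_le_one₀ zero_le val_q_lt_one.le

lemma val_q_zpow_lt_one {m : ℤ} (hm : 0 < m) : val (q ^ m) < 1 := by
  have h : q ^ m = q * q ^ (m - 1) := by
    rw [← zpow_one_add₀ q_ne_zero]
    congr 1
    ring
  rw [h, map_mul]
  exact mul_lt_one_of_lt_of_le val_q_lt_one (val_q_zpow_le_one (by omega))

lemma qint_neg (m : ℤ) : qint (-m) = -qint m := by
  unfold qint
  rw [neg_neg, ← neg_div, neg_sub]

lemma one_sub_sq_ne_zero : (1 : Kq) - q ^ (2 : ℤ) ≠ 0 := by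
  rw [← Valuation.ne_zero_iff val, Valuation.map_one_sub_of_lt _ (val_q_zpow_lt_one two_pos)]
  exact one_ne_zero

lemma q_sub_inv : q - q⁻¹ = -q⁻¹ * (1 - q ^ (2 : ℤ)) := by
  have := q_ne_zero
  field_simp
  norm_cast
  ring

lemma q_sub_inv_ne_zero : q - q⁻¹ ≠ 0 := by
  rw [q_sub_inv]
  exact mul_ne_zero (neg_ne_zero.mpr (inv_ne_zero q_ne_zero)) one_sub_sq_ne_zero

lemma qint_mul_one_sub_sq (m : ℤ) :
    qint m * (1 - q ^ (2 : ℤ)) = q ^ (1 - m) * (1 - q ^ (2 * m)) := by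
  have h := q_sub_inv_ne_zero
  have hq := q_ne_zero
  have h1 : qint m * (q - q⁻¹) = q ^ m - q ^ (-m) := div_mul_cancel₀ _ h
  have h2 : (1 : Kq) - q ^ (2 : ℤ) = -q * (q - q⁻¹) := by
    rw [q_sub_inv]
    field_simp
  have h3 : q ^ (1 - m) * q ^ (2 * m) = q * q ^ m := by
    rw [← zpow_add₀ hq, ← zpow_one_add₀ hq]
    congr 1
    ring
  have h4 : q ^ (1 - m) = q * q ^ (-m) := by
    rw [← zpow_one_add₀ hq]
    congr 1
  rw [mul_sub (q ^ (1 - m)), h3, h2, h4]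
  linear_combination (-q) * h1

lemma val_qint_of_pos {m : ℤ} (hm : 0 < m) : val (qint m) = val (q ^ (1 - m)) := by
  have h := congrArg val (qint_mul_one_sub_sq m)
  rwa [map_mul, map_mul, Valuation.map_one_sub_of_lt _ (val_q_zpow_lt_one two_pos),
    Valuation.map_one_sub_of_lt _ (val_q_zpow_lt_one (by omega)), mul_one, mul_one] at h

/-- The middle quantum integers `[n-2k]`, `0 < k < n`, have a pole of order at most `n - 2`. -/
lemma val_zpow_mul_qint_le_one {n k : ℕ} (hk : 0 < k) (hkn : k < n) :
    val (q ^ ((n : ℤ) - 2) * qint ((n : ℤ) - 2 * k)) ≤ 1 := by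
  rcases lt_trichotomy ((n : ℤ) - 2 * k) 0 with h | h | h
  · have h' : qint ((n : ℤ) - 2 * k) = -qint (-((n : ℤ) - 2 * k)) := by rw [qint_neg, neg_neg]
    rw [h', mul_neg, Valuation.map_neg, map_mul, val_qint_of_pos (by omega), ← map_mul,
      ← zpow_add₀ q_ne_zero]
    exact val_q_zpow_le_one (by omega)
  · rw [h]
    simp [qint]
  · rw [map_mul, val_qint_of_pos h, ← map_mul, ← zpow_add₀ q_ne_zero]
    exact val_q_zpow_le_one (by omega)

/-- The quantum integer `[n]` has a pole of order exactly `n - 1`. -/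
lemma val_zpow_mul_qint_self {n : ℕ} (hn : 2 ≤ n) :
    val (q ^ ((n : ℤ) - 1) * qint (n : ℤ)) = 1 := by
  rw [map_mul, val_qint_of_pos (by omega), ← map_mul, ← zpow_add₀ q_ne_zero]
  simp

lemma qint_mul_sub (m : ℤ) : qint m * (q - q⁻¹) = q ^ m - q ^ (-m) :=
  div_mul_cancel₀ _ q_sub_inv_ne_zero

lemma qint_add_one (m : ℤ) : qint (m + 1) = q⁻¹ * qint m + q ^ m := by
  have hq := q_ne_zero
  apply mul_right_cancel₀ q_sub_inv_ne_zero
  rw [add_mul, mul_assoc, qint_mul_sub, qint_mul_sub, neg_add, zpow_add₀ hq, zpow_add₀ hq,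
    zpow_one, zpow_neg_one]
  ring

lemma qint_add_one_eq_q_mul (m : ℤ) : qint (m + 1) = q * qint m + q ^ (-m) := by
  rw [qint_add_one]
  linear_combination -qint_mul_sub m

lemma qint_sub_one (m : ℤ) : qint (m - 1) = q⁻¹ * qint m - q ^ (-m) := by
  have h := qint_add_one (-m)
  rw [show -m + 1 = -(m - 1) by ring, qint_neg, qint_neg] at h
  linear_combination -h

lemma qint_sub_one_eq_q_mul (m : ℤ) : qint (m - 1) = q * qint m - q ^ m := by
  rw [qint_sub_one]
  linear_combination -qint_mul_sub m

lemma q_zpow_add_zpow_neg_ne_zero (m : ℤ) : q ^ m + q ^ (-m) ≠ 0 := by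
  wlog hm : 0 ≤ m generalizing m
  · have h := this (-m) (by omega)
    rwa [neg_neg, add_comm] at h
  rcases hm.eq_or_lt with rfl | hpos
  · have h : (HahnSeries.C : ℚ →+* Kq) 2 ≠ 0 := HahnSeries.C_ne_zero two_ne_zero
    rw [map_ofNat] at h
    norm_num
    exact h
  · have h : q ^ m + q ^ (-m) = q ^ (-m) * (1 + q ^ (2 * m)) := by
      rw [mul_add, ← zpow_add₀ q_ne_zero, mul_one, add_comm]
      congr 2
      ring
    have h1 : (1 : Kq) + q ^ (2 * m) ≠ 0 := by
      rw [← Valuation.ne_zero_iff val,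
        Valuation.map_one_add_of_lt _ (val_q_zpow_lt_one (by omega))]
      exact one_ne_zero
    rw [h]
    exact mul_ne_zero (zpow_ne_zero _ q_ne_zero) h1

/-- A sequence whose valuations decay geometrically tends to `0`. -/
lemma tendsto_zero_of_val_le {a : ℕ → Kq} {N : WithZero (Multiplicative ℤ)}
    (h : ∀ m, val (a m) ≤ val q ^ m * N) : Filter.Tendsto a Filter.atTop (nhds 0) := by
  rw [(Valued.hasBasis_nhds_zero Kq _).tendsto_right_iff]
  intro γ _
  simp only [Set.mem_ofPred_eq, Valuation.restrict_lt_iff_lt_embedding]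
  set g := MonoidWithZeroHom.ValueGroup₀.embedding γ.1 with hg
  have hg0 : g ≠ 0 := by
    rw [hg]
    simp
  by_cases hN : N = 0
  · filter_upwards with m
    refine (h m).trans_lt ?_
    rw [hN, mul_zero]
    exact zero_lt_iff.mpr hg0
  · obtain ⟨m₀, hm₀⟩ := exists_pow_lt₀ val_q_lt_one (Units.mk0 (g / N) (div_ne_zero hg0 hN))
    filter_upwards [Filter.eventually_ge_atTop m₀] with m hm
    refine (h m).trans_lt ?_
    rw [← lt_div_iff₀ (zero_lt_iff.mpr hN)]
    exact (pow_le_pow_of_le_one zero_le val_q_lt_one.le hm).trans_lt hm₀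

/-! ### The operator `B` and flips of letters -/

/-- The coefficient `Π_{j > i} q^{ε(u_j)}` of `B`. -/
def wt (n : ℕ) (u : Fin n → Bool) (i : Fin n) : Kq :=
  ∏ j ∈ Finset.univ.filter (fun j => i < j), q ^ eps (u j)

lemma Bop_apply (n : ℕ) (f : W n) (u : Fin n → Bool) :
    Bop n f u = ∑ i, wt n u i * f (flipLetter n u i) := rfl

lemma flipLetter_same {n : ℕ} (u : Fin n → Bool) (i : Fin n) : flipLetter n u i i = !(u i) := by
  simp [flipLetter]

lemma flipLetter_of_ne {n : ℕ} (u : Fin n → Bool) {i j : Fin n} (h : j ≠ i) :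
    flipLetter n u i j = u j := by
  simp [flipLetter, h]

lemma flipLetter_flipLetter {n : ℕ} (u : Fin n → Bool) (i : Fin n) :
    flipLetter n (flipLetter n u i) i = u := by
  simp [flipLetter]

lemma flipLetter_comm {n : ℕ} (u : Fin n → Bool) (i j : Fin n) :
    flipLetter n (flipLetter n u i) j = flipLetter n (flipLetter n u j) i := by
  ext k
  by_cases hij : i = j
  · rw [hij]
  · by_cases hi : k = i <;> by_cases hj : k = j <;> simp_all [flipLetter]

lemma comp_swap_eq_flip {n : ℕ} (u : Fin n → Bool) {p p' : Fin n} (h : u p ≠ u p') :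
    u ∘ Equiv.swap p p' = flipLetter n (flipLetter n u p) p' := by
  have hp : p ≠ p' := fun e => h (by rw [e])
  ext k
  by_cases h1 : k = p
  · subst h1
    rw [flipLetter_of_ne _ hp, flipLetter_same, Function.comp_apply, Equiv.swap_apply_left]
    cases hk : u k <;> cases hk' : u p' <;> simp_all
  · by_cases h2 : k = p'
    · subst h2
      rw [flipLetter_same, flipLetter_of_ne _ h1, Function.comp_apply, Equiv.swap_apply_right]
      cases hk : u k <;> cases hk' : u p <;> simp_all
    · rw [flipLetter_of_ne _ h2, flipLetter_of_ne _ h1, Function.comp_apply,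
        Equiv.swap_apply_of_ne_of_ne h1 h2]

lemma uhatAt_apply_of_eq {n : ℕ} {p p' : Fin n} (f : W n) {u : Fin n → Bool} (h : u p = u p') :
    uhatAt n p p' f u = 0 := if_pos h

lemma uhatAt_apply_of_ne {n : ℕ} {p p' : Fin n} (f : W n) {u : Fin n → Bool} (h : u p ≠ u p') :
    uhatAt n p p' f u = f (flipLetter n (flipLetter n u p) p') - q ^ eps (u p) * f u := by
  rw [← comp_swap_eq_flip u h]
  refine (if_neg h).trans ?_
  cases u p
  · simp [eps]
    ring
  · simp [eps]

lemma q_zpow_eps_not (b : Bool) : q ^ eps (!b) = (q ^ eps b)⁻¹ := by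
  cases b <;> simp [eps]

lemma wt_flipLetter_of_le {n : ℕ} (u : Fin n → Bool) {i j : Fin n} (h : j ≤ i) :
    wt n (flipLetter n u j) i = wt n u i := by
  refine Finset.prod_congr rfl fun k hk => ?_
  rw [flipLetter_of_ne _ (ne_of_gt (h.trans_lt (Finset.mem_filter.mp hk).2))]

lemma wt_eq_mul_wt_succ {n : ℕ} (u : Fin n → Bool) {p p' : Fin n} (h : (p' : ℕ) = p + 1) :
    wt n u p = q ^ eps (u p') * wt n u p' := by
  have : Finset.univ.filter (fun j => p < j) = insert p' (Finset.univ.filter (fun j => p' < j)) := by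
    ext j
    simp only [Finset.mem_filter, Finset.mem_univ, true_and, Finset.mem_insert, Fin.lt_def,
      Fin.ext_iff]
    omega
  unfold wt
  rw [this, Finset.prod_insert (by simp)]

lemma wt_flip_flip {n : ℕ} (u : Fin n → Bool) {p p' : Fin n} (h : (p' : ℕ) = p + 1)
    (hu : u p ≠ u p') {i : Fin n} (hi : i ≠ p) :
    wt n (flipLetter n (flipLetter n u p) p') i = wt n u i := by
  rcases lt_or_gt_of_ne hi with hlt | hgt
  · rw [← comp_swap_eq_flip u hu]
    refine Finset.prod_equiv (Equiv.swap p p') (fun j => ?_) (fun j _ => rfl)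
    simp only [Finset.mem_filter, Finset.mem_univ, true_and, Equiv.swap_apply_def]
    have hlt' : i < p' := by
      rw [Fin.lt_def] at hlt ⊢
      omega
    split_ifs with h1 h2
    · simp [h1, hlt, hlt']
    · simp [h2, hlt, hlt']
    · rfl
  · rw [wt_flipLetter_of_le _ (by rw [Fin.le_def]; rw [Fin.lt_def] at hgt; omega),
      wt_flipLetter_of_le _ hgt.le]

lemma sum_eq_add_add_sum {n : ℕ} {p p' : Fin n} (hp : p ≠ p') (g : Fin n → Kq) :
    ∑ i, g i = g p + g p' + ∑ i ∈ (Finset.univ.erase p).erase p', g i := by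
  rw [add_assoc, Finset.add_sum_erase _ _ (by simp [hp.symm]),
    Finset.add_sum_erase _ _ (Finset.mem_univ _)]

/-- `B` commutes with the cup–cap operator on two adjacent letters. -/
lemma commute_Bop_uhatAt {n : ℕ} {p p' : Fin n} (h : (p' : ℕ) = p + 1) :
    Commute (Bop n) (uhatAt n p p') := by
  have hp : p ≠ p' := by
    rw [Ne, Fin.ext_iff]
    omega
  have hw := fun u => wt_eq_mul_wt_succ (n := n) u h
  have hrest : ∀ i ∈ (Finset.univ.erase p).erase p', p ≠ i ∧ p' ≠ i := fun i hi =>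
    ⟨(Finset.mem_erase.mp (Finset.mem_erase.mp hi).2).1.symm, (Finset.mem_erase.mp hi).1.symm⟩
  refine LinearMap.ext fun f => funext fun u => ?_
  simp only [Module.End.mul_apply]
  rw [Bop_apply, sum_eq_add_add_sum hp, hw]
  have ht : q ^ eps (u p') ≠ 0 := zpow_ne_zero _ q_ne_zero
  by_cases hu : u p = u p'
  · rw [uhatAt_apply_of_eq _ hu, Finset.sum_eq_zero fun i hi => by
        rw [uhatAt_apply_of_eq _ (by rw [flipLetter_of_ne _ (hrest i hi).1,
          flipLetter_of_ne _ (hrest i hi).2, hu]), mul_zero],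
      uhatAt_apply_of_ne (u := flipLetter n u p) _ (by
        rw [flipLetter_same, flipLetter_of_ne _ hp.symm, hu]; simp),
      uhatAt_apply_of_ne (u := flipLetter n u p') _ (by
        rw [flipLetter_same, flipLetter_of_ne _ hp, hu]; simp),
      flipLetter_flipLetter, flipLetter_same, flipLetter_of_ne _ hp, flipLetter_comm _ p' p,
      flipLetter_flipLetter, q_zpow_eps_not, hu]
    field_simp
    ring
  · have hu' : u p = !(u p') := by
      revert hu
      cases u p <;> cases u p' <;> simp
    have hsum : ∑ i ∈ (Finset.univ.erase p).erase p',
          wt n u i * uhatAt n p p' f (flipLetter n u i) =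
        ∑ i ∈ (Finset.univ.erase p).erase p',
          wt n (flipLetter n (flipLetter n u p) p') i *
            f (flipLetter n (flipLetter n (flipLetter n u p) p') i) -
        q ^ eps (u p) * ∑ i ∈ (Finset.univ.erase p).erase p', wt n u i * f (flipLetter n u i) := by
      rw [Finset.mul_sum, ← Finset.sum_sub_distrib]
      refine Finset.sum_congr rfl fun i hi => ?_
      rw [uhatAt_apply_of_ne _ (by rwa [flipLetter_of_ne _ (hrest i hi).1,
          flipLetter_of_ne _ (hrest i hi).2]), flipLetter_of_ne _ (hrest i hi).1,
        flipLetter_comm u i p, flipLetter_comm _ i p',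
        wt_flip_flip u h hu (hrest i hi).1.symm]
      ring
    rw [uhatAt_apply_of_ne _ hu, Bop_apply, Bop_apply, sum_eq_add_add_sum hp,
      sum_eq_add_add_sum hp (fun i => wt n u i * _), hw, hw,
      wt_flip_flip u h hu hp.symm, hsum,
      uhatAt_apply_of_eq (u := flipLetter n u p) _ (by
        rw [flipLetter_same, flipLetter_of_ne _ hp.symm, hu', Bool.not_not]),
      uhatAt_apply_of_eq (u := flipLetter n u p') _ (by
        rw [flipLetter_same, flipLetter_of_ne _ hp, hu']),
      flipLetter_same, flipLetter_of_ne _ hp.symm, flipLetter_flipLetter,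
      flipLetter_comm _ p' p, flipLetter_flipLetter, hu', q_zpow_eps_not]
    field_simp
    ring

lemma S0_apply {n : ℕ} (hn : 0 < n) (f : W n) (u : Fin n → Bool) :
    S0 n f u = f (flipLetter n u ⟨0, hn⟩) := by
  simp [S0, hn]

lemma commute_Bop_S0 {n : ℕ} (hn : 0 < n) : Commute (Bop n) (S0 n) := by
  refine LinearMap.ext fun f => funext fun u => ?_
  simp only [Module.End.mul_apply]
  rw [S0_apply hn, Bop_apply, Bop_apply]
  refine Finset.sum_congr rfl fun i _ => ?_
  rw [S0_apply hn, flipLetter_comm, wt_flipLetter_of_le _ (Fin.mk_le_of_le_val (Nat.zero_le _))]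

lemma commute_Bop_uhat (n i : ℕ) : Commute (Bop n) (uhat n i) := by
  unfold uhat
  split_ifs with h h0
  · exact commute_Bop_uhatAt (by simp only; omega)
  · have hn : 0 < n := by omega
    exact ((commute_Bop_S0 hn).mul_right (commute_Bop_uhatAt rfl)).mul_right (commute_Bop_S0 hn)
  · exact Commute.zero_right _

/-! ### Diagonalization of `B` -/

/-- Appending a letter: the vector `f ⊗ c` of `W (n + 1)`, for `f ∈ W n` and `c ∈ V`. -/
def tensorLetter (n : ℕ) (c : Bool → Kq) : W n →ₗ[Kq] W (n + 1) where
  toFun f := fun u => f (Fin.init u) * c (u (Fin.last n))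
  map_add' f g := by
    funext u
    exact add_mul _ _ _
  map_smul' a f := by
    funext u
    exact mul_assoc _ _ _

lemma tensorLetter_apply {n : ℕ} (c : Bool → Kq) (f : W n) (u : Fin (n + 1) → Bool) :
    tensorLetter n c f u = f (Fin.init u) * c (u (Fin.last n)) := rfl

lemma wt_last {n : ℕ} (u : Fin (n + 1) → Bool) : wt (n + 1) u (Fin.last n) = 1 := by
  refine Finset.prod_eq_one fun j hj => ?_
  exact absurd (Finset.mem_filter.mp hj).2 (not_lt.mpr (Fin.le_last j))

lemma wt_castSucc {n : ℕ} (u : Fin (n + 1) → Bool) (i : Fin n) :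
    wt (n + 1) u i.castSucc = wt n (Fin.init u) i * q ^ eps (u (Fin.last n)) := by
  unfold wt
  rw [Finset.prod_filter, Fin.prod_univ_castSucc, Finset.prod_filter]
  simp [Fin.init, Fin.castSucc_lt_last]

lemma init_flipLetter_castSucc {n : ℕ} (u : Fin (n + 1) → Bool) (i : Fin n) :
    Fin.init (flipLetter (n + 1) u i.castSucc) = flipLetter n (Fin.init u) i := by
  simp [flipLetter, Fin.init]

/-- `B` on `V^{⊗(n+1)}` is `B ⊗ K + 1 ⊗ X`. -/
lemma Bop_tensorLetter {n : ℕ} (c : Bool → Kq) (f : W n) (u : Fin (n + 1) → Bool) :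
    Bop (n + 1) (tensorLetter n c f) u =
      Bop n f (Fin.init u) * (q ^ eps (u (Fin.last n)) * c (u (Fin.last n))) +
        f (Fin.init u) * c (!u (Fin.last n)) := by
  rw [Bop_apply, Bop_apply, Fin.sum_univ_castSucc, Finset.sum_mul]
  congr 1
  · refine Finset.sum_congr rfl fun i _ => ?_
    rw [wt_castSucc, tensorLetter_apply, init_flipLetter_castSucc,
      flipLetter_of_ne _ (Fin.castSucc_lt_last i).ne']
    ring
  · rw [wt_last, one_mul, tensorLetter_apply, flipLetter_same]
    congr 2
    funext i
    exact flipLetter_of_ne _ (Fin.castSucc_lt_last i).ne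

lemma tensorLetter_mem_eigenspace {n : ℕ} {a b s : Kq} {f : W n}
    (hf : f ∈ Module.End.eigenspace (Bop n) a) (h₀ : b = q⁻¹ * a + s) (h₁ : b * s = q * a * s + 1) :
    tensorLetter n (fun l => if l then s else 1) f ∈ Module.End.eigenspace (Bop (n + 1)) b := by
  rw [Module.End.mem_eigenspace_iff] at hf ⊢
  funext u
  rw [Bop_tensorLetter, hf, Pi.smul_apply, Pi.smul_apply, tensorLetter_apply]
  simp only [smul_eq_mul]
  cases u (Fin.last n)
  · simp only [eps, Bool.not_false, if_true, Bool.false_eq_true, if_false, zpow_neg_one, h₀]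
    ring
  · simp only [eps, Bool.not_true, if_true, Bool.false_eq_true, if_false, zpow_one]
    linear_combination -(f (Fin.init u)) * h₁

/-- `W n` is spanned by the eigenspaces of `B` for the eigenvalues `[n-2k]`. -/
lemma iSup_eigenspace_Bop (n : ℕ) :
    ⨆ k : Fin (n + 1), Module.End.eigenspace (Bop n) (qint ((n : ℤ) - 2 * (k : ℕ))) = ⊤ := by
  induction n with
  | zero =>
    rw [eq_top_iff]
    intro f _
    refine Submodule.mem_iSup_of_mem 0 ?_
    rw [Module.End.mem_eigenspace_iff]
    funext u
    simp [Bop_apply, qint]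
  | succ n ih =>
    set S := ⨆ k : Fin (n + 1 + 1),
      Module.End.eigenspace (Bop (n + 1)) (qint (((n + 1 : ℕ) : ℤ) - 2 * (k : ℕ))) with hS
    have key : ∀ (c : Bool → Kq) (f : W n), tensorLetter n c f ∈ S := by
      intro c
      suffices h : (⊤ : Submodule Kq (W n)) ≤ S.comap (tensorLetter n c) from
        fun f => h Submodule.mem_top
      rw [← ih]
      refine iSup_le fun k f hf => ?_
      rw [Submodule.mem_comap]
      set m : ℤ := (n : ℤ) - 2 * (k : ℕ) with hm
      have hq := q_ne_zero
      have ht : q ^ m ≠ 0 := zpow_ne_zero _ hq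
      have hplus : tensorLetter n (fun l => if l then q ^ m else 1) f ∈ S := by
        refine Submodule.mem_iSup_of_mem k.castSucc ?_
        have h := tensorLetter_mem_eigenspace hf (qint_add_one m) (by
          rw [qint_add_one_eq_q_mul, zpow_neg]
          field_simp)
        convert h using 3
        push_cast [hm]
        simp
        ring
      have hminus : tensorLetter n (fun l => if l then -q ^ (-m) else 1) f ∈ S := by
        refine Submodule.mem_iSup_of_mem k.succ ?_
        have h := tensorLetter_mem_eigenspace hf
          ((qint_sub_one m).trans (sub_eq_add_neg _ _)) (by
          rw [qint_sub_one_eq_q_mul, zpow_neg]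
          field_simp
          ring)
        convert h using 3
        push_cast [hm]
        simp
        ring
      have hd : q ^ m + q ^ (-m) ≠ 0 := q_zpow_add_zpow_neg_ne_zero m
      have hcomb : tensorLetter n c f =
          ((c true + q ^ (-m) * c false) / (q ^ m + q ^ (-m))) •
              tensorLetter n (fun l => if l then q ^ m else 1) f +
            ((q ^ m * c false - c true) / (q ^ m + q ^ (-m))) •
              tensorLetter n (fun l => if l then -q ^ (-m) else 1) f := by
        funext u
        rw [Pi.add_apply, Pi.smul_apply, Pi.smul_apply, tensorLetter_apply, tensorLetter_apply,
          tensorLetter_apply]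
        simp only [smul_eq_mul]
        generalize q ^ (-m) = t' at hd ⊢
        generalize q ^ m = t at hd ⊢
        cases u (Fin.last n)
        · simp only [Bool.false_eq_true, if_false]
          field_simp
          ring
        · simp only [if_true]
          field_simp
          ring
      rw [hcomb]
      exact S.add_mem (S.smul_mem _ hplus) (S.smul_mem _ hminus)
    rw [eq_top_iff]
    intro g _
    have hg : g = tensorLetter n (fun l => if l then 1 else 0) (fun w => g (Fin.snoc w true)) +
        tensorLetter n (fun l => if l then 0 else 1) (fun w => g (Fin.snoc w false)) := by
      funext u
      rw [Pi.add_apply, tensorLetter_apply, tensorLetter_apply]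
      have hu := Fin.snoc_init_self u
      cases h : u (Fin.last n) <;> rw [h] at hu <;> simp [hu]
    rw [hg]
    exact S.add_mem (key _ _) (key _ _)

/-! ### Valuation estimates for eigenvectors of `B` -/

lemma wt_eq_zpow {n : ℕ} (u : Fin n → Bool) (i : Fin n) :
    wt n u i = q ^ ∑ j ∈ Finset.Ioi i, eps (u j) := by
  unfold wt
  rw [Finset.filter_lt_eq_Ioi]
  induction Finset.Ioi i using Finset.cons_induction with
  | empty => simp
  | cons a s ha ih => rw [Finset.prod_cons, Finset.sum_cons, ih, zpow_add₀ q_ne_zero]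

lemma wt_zero_of_forall_false {n : ℕ} (hn : 0 < n) {u : Fin n → Bool}
    (hu : ∀ j : Fin n, j ≠ ⟨0, hn⟩ → u j = false) :
    wt n u ⟨0, hn⟩ = q ^ (1 - (n : ℤ)) := by
  rw [wt_eq_zpow, Finset.sum_congr rfl (g := fun _ => (-1 : ℤ))]
  · rw [Finset.sum_const, Fin.card_Ioi]
    congr 1
    simp only [nsmul_eq_mul]
    omega
  · intro j hj
    rw [hu j (Finset.mem_Ioi.mp hj).ne']
    rfl

lemma val_wt_le {n : ℕ} (u : Fin n → Bool) (i : Fin n)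
    (h : 0 < (i : ℕ) ∨ ∃ j, i < j ∧ u j = true) :
    val (q ^ ((n : ℤ) - 2) * wt n u i) ≤ 1 := by
  rw [wt_eq_zpow, ← zpow_add₀ q_ne_zero]
  apply val_q_zpow_le_one
  have hcard : ∑ j ∈ Finset.Ioi i, (eps (u j) + 1) =
      ∑ j ∈ Finset.Ioi i, eps (u j) + ((n - 1 - i : ℕ) : ℤ) := by
    rw [Finset.sum_add_distrib, Finset.sum_const, Fin.card_Ioi]
    simp
  have hnonneg : ∀ j ∈ Finset.Ioi i, 0 ≤ eps (u j) + 1 := fun j _ => by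
    cases u j <;> simp [eps]
  have hi := i.isLt
  rcases h with h | ⟨j, hij, hj⟩
  · have := Finset.sum_nonneg hnonneg
    omega
  · have := Finset.single_le_sum hnonneg (Finset.mem_Ioi.mpr hij)
    rw [hj, show eps true = 1 from rfl] at this
    omega

/-- All terms of `B` but the one flipping the first letter have a pole of order at most
`n - 2`. -/
lemma val_Bop_sub_le {n : ℕ} (hn : 0 < n) {N : WithZero (Multiplicative ℤ)} {f : W n}
    (hf : ∀ u, val (f u) ≤ N) (u : Fin n → Bool) :
    val (q ^ ((n : ℤ) - 2) *
      (Bop n f u - wt n u ⟨0, hn⟩ * f (flipLetter n u ⟨0, hn⟩))) ≤ N := by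
  rw [Bop_apply, ← Finset.add_sum_erase _ _ (Finset.mem_univ (⟨0, hn⟩ : Fin n)),
    add_sub_cancel_left, Finset.mul_sum]
  refine Valuation.map_sum_le _ fun i hi => ?_
  rw [← mul_assoc, map_mul]
  have hi0 : 0 < (i : ℕ) := by
    have := (Finset.mem_erase.mp hi).1
    rw [Ne, Fin.ext_iff] at this
    exact Nat.pos_of_ne_zero this
  exact (mul_le_mul' (val_wt_le u i (Or.inl hi0)) (hf _)).trans_eq (one_mul N)

/-- An eigenvector of `B` for an eigenvalue with a pole of order at most `n - 2` is small at the
two words whose letters after the first are all `x`. -/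
lemma val_apply_le_of_eigenvector {n : ℕ} (hn : 0 < n) {a : Kq}
    (ha : val (q ^ ((n : ℤ) - 2) * a) ≤ 1) {f : W n}
    (hf : f ∈ Module.End.eigenspace (Bop n) a) {N : WithZero (Multiplicative ℤ)}
    (hN : ∀ u, val (f u) ≤ N) {u : Fin n → Bool}
    (hu : ∀ j : Fin n, j ≠ ⟨0, hn⟩ → u j = false) : val (f u) ≤ val q * N := by
  have h := val_Bop_sub_le hn hN (flipLetter n u ⟨0, hn⟩)
  rw [Module.End.mem_eigenspace_iff.mp hf, flipLetter_flipLetter, wt_flipLetter_of_le _ le_rfl,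
    wt_zero_of_forall_false hn hu, Pi.smul_apply, smul_eq_mul] at h
  set b := f (flipLetter n u ⟨0, hn⟩) with hb
  have hab : val (q ^ ((n : ℤ) - 2) * a * b) ≤ N := by
    rw [map_mul]
    exact (mul_le_mul' ha (hN _)).trans_eq (one_mul N)
  have hq : q ^ ((n : ℤ) - 2) * q ^ (1 - (n : ℤ)) * q = 1 := by
    rw [← zpow_add₀ q_ne_zero, ← zpow_add_one₀ q_ne_zero]
    ring_nf
    exact zpow_zero _
  have hfu : f u = q * (q ^ ((n : ℤ) - 2) * a * b -
      q ^ ((n : ℤ) - 2) * (a * b - q ^ (1 - (n : ℤ)) * f u)) := by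
    linear_combination -(f u) * hq
  rw [hfu, map_mul]
  exact mul_le_mul' le_rfl (Valuation.map_sub_le _ hab h)

/-- An eigenvector of `B` for an eigenvalue with a pole of order exactly `n - 1` that vanishes at
the word `x⋯x` is zero. -/
lemma eigenvector_eq_zero {n : ℕ} (hn : 0 < n) {a : Kq}
    (ha : val (q ^ ((n : ℤ) - 1) * a) = 1) {f : W n}
    (hf : f ∈ Module.End.eigenspace (Bop n) a) (hf0 : f (fun _ => false) = 0) : f = 0 := by
  by_contra hne
  obtain ⟨u₀, hu₀⟩ := Finite.exists_max (fun u => val (f u))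
  have hN : val (f u₀) ≠ 0 := by
    intro h0
    refine hne (funext fun u => ?_)
    have := hu₀ u
    rw [h0, le_zero_iff, Valuation.zero_iff] at this
    exact this
  have h := val_Bop_sub_le hn hu₀ u₀
  have hfirst : val (q ^ ((n : ℤ) - 2) *
      (wt n u₀ ⟨0, hn⟩ * f (flipLetter n u₀ ⟨0, hn⟩))) ≤ val (f u₀) := by
    by_cases hu : ∃ j : Fin n, ⟨0, hn⟩ < j ∧ u₀ j = true
    · rw [← mul_assoc, map_mul]
      exact (mul_le_mul' (val_wt_le u₀ _ (Or.inr hu)) (hu₀ _)).trans_eq (one_mul _)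
    · have hfalse : ∀ j : Fin n, j ≠ ⟨0, hn⟩ → u₀ j = false := by
        intro j hj
        by_contra hcon
        refine hu ⟨j, ?_, Bool.not_eq_false _ ▸ hcon⟩
        rw [Fin.lt_def]
        rw [Ne, Fin.ext_iff] at hj
        exact Nat.pos_of_ne_zero hj
      have hflip : f (flipLetter n u₀ ⟨0, hn⟩) = 0 := by
        rw [← hf0]
        congr 1
        funext j
        by_cases hj : j = ⟨0, hn⟩
        · rw [hj, flipLetter_same]
          by_contra hcon
          refine hN ?_
          rw [Valuation.zero_iff, ← hf0]
          congr 1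
          funext i
          by_cases hi : i = ⟨0, hn⟩
          · rw [hi]
            simpa using hcon
          · exact hfalse i hi
        · rw [flipLetter_of_ne _ hj, hfalse j hj]
      rw [hflip, mul_zero, mul_zero, map_zero]
      exact zero_le
  have hle := Valuation.map_add_le _ h hfirst
  rw [← mul_add, sub_add_cancel, Module.End.mem_eigenspace_iff.mp hf, Pi.smul_apply, smul_eq_mul,
    ← mul_assoc, map_mul] at hle
  have hle1 : val (q ^ ((n : ℤ) - 2) * a) ≤ 1 :=
    (mul_le_iff_le_one_left (zero_lt_iff.mpr hN)).mp hle
  have hqa : q ^ ((n : ℤ) - 1) * a = q * (q ^ ((n : ℤ) - 2) * a) := by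
    rw [← mul_assoc, ← zpow_one_add₀ q_ne_zero]
    congr 2
    ring
  rw [hqa, map_mul] at ha
  exact (mul_lt_one_of_lt_of_le val_q_lt_one hle1).ne ha

/-! ### The braid generators modulo `q` -/

/-- `A` is integral, preserves smallness modulo `q` at each word, and produces values that are
small modulo `q` at the words of `K`. -/
def Contracts {n : ℕ} (A : Module.End Kq (W n)) (K : Set (Fin n → Bool)) : Prop :=
  ∀ (N : WithZero (Multiplicative ℤ)) (f : W n), (∀ u, val (f u) ≤ N) →
    (∀ u, val (A f u) ≤ N) ∧ ∀ u, (val (f u) ≤ val q * N ∨ u ∈ K) → val (A f u) ≤ val q * N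

lemma Contracts.mono {n : ℕ} {A : Module.End Kq (W n)} {K K' : Set (Fin n → Bool)}
    (h : Contracts A K) (hK : K' ⊆ K) : Contracts A K' := fun N f hf =>
  ⟨(h N f hf).1, fun u hu => (h N f hf).2 u (hu.imp_right fun hu => hK hu)⟩

lemma contracts_one {n : ℕ} : Contracts (1 : Module.End Kq (W n)) ∅ := fun _ _ hf =>
  ⟨hf, fun _ hu => hu.resolve_right (Set.notMem_empty _)⟩

lemma Contracts.mul {n : ℕ} {A A' : Module.End Kq (W n)} {K K' : Set (Fin n → Bool)}
    (h : Contracts A K) (h' : Contracts A' K') : Contracts (A * A') (K ∪ K') := by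
  intro N f hf
  obtain ⟨h1, h2⟩ := h' N f hf
  obtain ⟨h3, h4⟩ := h N (A' f) h1
  refine ⟨h3, fun u hu => h4 u ?_⟩
  rcases hu with hu | hu | hu
  · exact Or.inl (h2 u (Or.inl hu))
  · exact Or.inr hu
  · exact Or.inl (h2 u (Or.inr hu))

lemma contracts_list_prod {n : ℕ} {l : List (Module.End Kq (W n))}
    (hl : ∀ A ∈ l, Contracts A ∅) : Contracts l.prod ∅ := by
  induction l with
  | nil => exact contracts_one
  | cons A l ih =>
    rw [List.prod_cons, ← Set.union_empty ∅]
    exact (hl A List.mem_cons_self).mul (ih fun B hB => hl B (List.mem_cons_of_mem _ hB))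

lemma contracts_list_prod_of_mem {n : ℕ} {l : List (Module.End Kq (W n))}
    (hl : ∀ A ∈ l, Contracts A ∅) {A : Module.End Kq (W n)} (hA : A ∈ l)
    {K : Set (Fin n → Bool)} (hK : Contracts A K) : Contracts l.prod K := by
  obtain ⟨s, t, rfl⟩ := List.append_of_mem hA
  rw [List.prod_append, List.prod_cons]
  refine ((contracts_list_prod fun B hB => hl B (by simp [hB])).mul
    (hK.mul (contracts_list_prod fun B hB => hl B (by simp [hB])))).mono ?_
  simp

lemma contracts_one_add_uhatAt {n : ℕ} (p p' : Fin n) :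
    Contracts (1 + q • uhatAt n p p') {u | u p = false ∧ u p' = true} := by
  intro N f hf
  have hq := val_q_lt_one.le
  have hqN : ∀ u, val (q * f u) ≤ val q * N := fun u => by
    rw [map_mul]
    exact mul_le_mul' le_rfl (hf u)
  have hqN' : val q * N ≤ N := mul_le_of_le_one_left' hq
  have hkill : ∀ u, u p = false → u p' = true →
      (1 + q • uhatAt n p p') f u = q * f (flipLetter n (flipLetter n u p) p') := by
    intro u h1 h2
    rw [LinearMap.add_apply, Pi.add_apply, LinearMap.smul_apply, Pi.smul_apply, smul_eq_mul,
      uhatAt_apply_of_ne _ (by simp [h1, h2]), h1, Module.End.one_apply]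
    have := q_ne_zero
    simp only [eps, Bool.false_eq_true, if_false, zpow_neg_one]
    field_simp
    ring
  have hrest : ∀ u, ¬(u p = false ∧ u p' = true) → ∀ M, val (f u) ≤ M → val q * N ≤ M →
      val ((1 + q • uhatAt n p p') f u) ≤ M := by
    intro u hu M hM hNM
    rw [LinearMap.add_apply, Pi.add_apply, LinearMap.smul_apply, Pi.smul_apply, smul_eq_mul,
      Module.End.one_apply]
    refine Valuation.map_add_le _ hM ?_
    by_cases h : u p = u p'
    · rw [uhatAt_apply_of_eq _ h, mul_zero, map_zero]
      exact zero_le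
    · have h1 : u p = true := by
        revert h hu
        cases u p <;> cases u p' <;> simp
      rw [uhatAt_apply_of_ne _ h, h1, mul_sub]
      refine Valuation.map_sub_le _ ((hqN _).trans hNM) ?_
      simp only [eps, if_true, zpow_one]
      rw [map_mul, map_mul]
      exact (mul_le_of_le_one_left' hq).trans ((mul_le_of_le_one_left' hq).trans hM)
  refine ⟨fun u => ?_, fun u hu => ?_⟩ <;> by_cases h : u p = false ∧ u p' = true
  · rw [hkill u h.1 h.2]
    exact (hqN _).trans hqN'
  · exact hrest u h N (hf u) hqN'
  · rw [hkill u h.1 h.2]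
    exact hqN _
  · exact hrest u h _ (hu.resolve_right h) le_rfl

lemma S0_mul_S0 (n : ℕ) : S0 n * S0 n = 1 := by
  rcases Nat.eq_zero_or_pos n with rfl | hn
  · simp [S0]
  · refine LinearMap.ext fun f => funext fun u => ?_
    rw [Module.End.mul_apply, S0_apply hn, S0_apply hn, flipLetter_flipLetter,
      Module.End.one_apply]

lemma Contracts.conj_S0 {n : ℕ} (hn : 0 < n) {A : Module.End Kq (W n)}
    {K : Set (Fin n → Bool)} (h : Contracts A K) :
    Contracts (S0 n * A * S0 n) {u | flipLetter n u ⟨0, hn⟩ ∈ K} := by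
  intro N f hf
  obtain ⟨h1, h2⟩ := h N (S0 n f) fun u => by
    rw [S0_apply hn]
    exact hf _
  refine ⟨fun u => ?_, fun u hu => ?_⟩
  · rw [Module.End.mul_apply, Module.End.mul_apply, S0_apply hn]
    exact h1 _
  · rw [Module.End.mul_apply, Module.End.mul_apply, S0_apply hn]
    refine h2 _ (hu.imp_left fun hu => ?_)
    rwa [S0_apply hn, flipLetter_flipLetter]

lemma contracts_sigma_succ {n i : ℕ} (h : i + 1 < n) :
    Contracts (1 + q • uhat n (i + 1))
      {u | u ⟨i, by omega⟩ = false ∧ u ⟨i + 1, h⟩ = true} := by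
  have : uhat n (i + 1) = uhatAt n ⟨i, by omega⟩ ⟨i + 1, h⟩ := by
    unfold uhat
    rw [dif_pos ⟨by omega, h⟩]
    rfl
  rw [this]
  exact contracts_one_add_uhatAt _ _

lemma uhat_zero {n : ℕ} (hn : 2 ≤ n) :
    uhat n 0 = S0 n * uhatAt n ⟨0, by omega⟩ ⟨1, by omega⟩ * S0 n := by
  unfold uhat
  rw [dif_neg (by omega), dif_pos ⟨rfl, hn⟩]

lemma contracts_sigma_zero {n : ℕ} (hn : 2 ≤ n) :
    Contracts (1 + q • uhat n 0)
      {u | u ⟨0, by omega⟩ = true ∧ u ⟨1, by omega⟩ = true} := by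
  have hsig : 1 + q • uhat n 0 =
      S0 n * (1 + q • uhatAt n ⟨0, by omega⟩ ⟨1, by omega⟩) * S0 n := by
    rw [uhat_zero hn, mul_add, add_mul, mul_one, S0_mul_S0, mul_smul_comm, smul_mul_assoc]
  rw [hsig]
  refine ((contracts_one_add_uhatAt _ _).conj_S0 (by omega)).mono fun u hu => ?_
  refine ⟨?_, ?_⟩
  · rw [flipLetter_same, hu.1]
    rfl
  · rw [flipLetter_of_ne _ (by simp), hu.2]

/-- The image of the Coxeter element `σ₀'σ₁⋯σ_{n-1}`. -/
def coxeter (n : ℕ) : Module.End Kq (W n) :=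
  ((List.range n).map (fun i => (1 : Module.End Kq (W n)) + q • uhat n i)).prod

lemma fullTwist_eq_coxeter_pow (n : ℕ) : fullTwist n = coxeter n ^ (2 * (n - 1)) := rfl

lemma contracts_coxeter {n : ℕ} (hn : 2 ≤ n) :
    Contracts (coxeter n) {u | ∃ j : Fin n, j ≠ ⟨0, by omega⟩ ∧ u j = true} := by
  have hl : ∀ A ∈ (List.range n).map (fun i => (1 : Module.End Kq (W n)) + q • uhat n i),
      Contracts A ∅ := by
    intro A hA
    obtain ⟨i, hi, rfl⟩ := List.mem_map.mp hA
    rw [List.mem_range] at hi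
    cases i with
    | zero => exact (contracts_sigma_zero hn).mono (Set.empty_subset _)
    | succ i => exact (contracts_sigma_succ hi).mono (Set.empty_subset _)
  have hmem : ∀ i < n, 1 + q • uhat n i ∈
      (List.range n).map (fun i => (1 : Module.End Kq (W n)) + q • uhat n i) :=
    fun i hi => List.mem_map.mpr ⟨i, List.mem_range.mpr hi, rfl⟩
  have hkill : ∀ (j : ℕ) (hj : j + 1 < n) (u : Fin n → Bool), u ⟨j + 1, hj⟩ = true →
      ∃ K, Contracts (coxeter n) K ∧ u ∈ K := by
    intro j
    induction j with
    | zero =>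
      intro hj u hu
      cases h0 : u ⟨0, by omega⟩
      · exact ⟨_, contracts_list_prod_of_mem hl (hmem 1 hj) (contracts_sigma_succ hj), h0, hu⟩
      · exact ⟨_, contracts_list_prod_of_mem hl (hmem 0 (by omega)) (contracts_sigma_zero hn),
          h0, hu⟩
    | succ j ih =>
      intro hj u hu
      cases h0 : u ⟨j + 1, by omega⟩
      · exact ⟨_, contracts_list_prod_of_mem hl (hmem (j + 2) hj) (contracts_sigma_succ hj), h0, hu⟩
      · exact ih (by omega) u h0
  intro N f hf
  refine ⟨((contracts_list_prod hl) N f hf).1, fun u hu => ?_⟩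
  rcases hu with hu | ⟨⟨j, hj⟩, hj0, hu⟩
  · exact ((contracts_list_prod hl) N f hf).2 u (Or.inl hu)
  · cases j with
    | zero => exact absurd rfl hj0
    | succ j =>
      obtain ⟨K, hK, huK⟩ := hkill j hj u hu
      exact (hK N f hf).2 u (Or.inr huK)

/-! ### The action of the Coxeter element on the eigenspaces of `B` -/

lemma mem_eigenspace_of_commute {n : ℕ} {A : Module.End Kq (W n)} (h : Commute (Bop n) A)
    {a : Kq} {f : W n} (hf : f ∈ Module.End.eigenspace (Bop n) a) :
    A f ∈ Module.End.eigenspace (Bop n) a := by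
  rw [Module.End.mem_eigenspace_iff] at hf ⊢
  rw [← Module.End.mul_apply, h.eq, Module.End.mul_apply, hf, map_smul]

lemma commute_Bop_coxeter (n : ℕ) : Commute (Bop n) (coxeter n) := by
  refine Commute.list_prod_right _ _ fun A hA => ?_
  obtain ⟨i, -, rfl⟩ := List.mem_map.mp hA
  exact (Commute.one_right _).add_right ((commute_Bop_uhat n i).smul_right q)

lemma uhatAt_eq_zero_of_eigenvector {n : ℕ} {p p' : Fin n} (h : (p' : ℕ) = p + 1) {a : Kq}
    (ha : val (q ^ ((n : ℤ) - 1) * a) = 1) {f : W n}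
    (hf : f ∈ Module.End.eigenspace (Bop n) a) : uhatAt n p p' f = 0 :=
  eigenvector_eq_zero p.pos ha (mem_eigenspace_of_commute (commute_Bop_uhatAt h) hf)
    (uhatAt_apply_of_eq f rfl)

lemma uhat_eq_zero_of_eigenvector {n : ℕ} (i : ℕ) {a : Kq}
    (ha : val (q ^ ((n : ℤ) - 1) * a) = 1) {f : W n}
    (hf : f ∈ Module.End.eigenspace (Bop n) a) : uhat n i f = 0 := by
  unfold uhat
  split_ifs with h h0
  · exact uhatAt_eq_zero_of_eigenvector (by simp only; omega) ha hf
  · rw [Module.End.mul_apply, Module.End.mul_apply, uhatAt_eq_zero_of_eigenvector rfl ha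
      (mem_eigenspace_of_commute (commute_Bop_S0 (by omega)) hf), map_zero]
  · rfl

lemma coxeter_apply_of_eigenvector {n : ℕ} {a : Kq}
    (ha : val (q ^ ((n : ℤ) - 1) * a) = 1) {f : W n}
    (hf : f ∈ Module.End.eigenspace (Bop n) a) : coxeter n f = f := by
  unfold coxeter
  induction List.range n with
  | nil => rfl
  | cons i l ih =>
    rw [List.map_cons, List.prod_cons, Module.End.mul_apply, ih, LinearMap.add_apply,
      LinearMap.smul_apply, uhat_eq_zero_of_eigenvector i ha hf, smul_zero, add_zero,
      Module.End.one_apply]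

lemma val_coxeter_pow_le {n : ℕ} (hn : 2 ≤ n) {a : Kq}
    (ha : val (q ^ ((n : ℤ) - 2) * a) ≤ 1) {f : W n}
    (hf : f ∈ Module.End.eigenspace (Bop n) a) {N : WithZero (Multiplicative ℤ)}
    (hN : ∀ u, val (f u) ≤ N) (m : ℕ) :
    (coxeter n ^ m) f ∈ Module.End.eigenspace (Bop n) a ∧
      ∀ u, val ((coxeter n ^ m) f u) ≤ val q ^ m * N := by
  induction m with
  | zero => simpa using ⟨by simpa using hf, hN⟩
  | succ m ih =>
    rw [pow_succ', Module.End.mul_apply]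
    refine ⟨mem_eigenspace_of_commute (commute_Bop_coxeter n) ih.1, fun u => ?_⟩
    rw [pow_succ', mul_assoc]
    refine (contracts_coxeter hn _ _ ih.2).2 u ?_
    by_cases hu : ∃ j : Fin n, j ≠ ⟨0, by omega⟩ ∧ u j = true
    · exact Or.inr hu
    · push Not at hu
      exact Or.inl (val_apply_le_of_eigenvector (by omega) ha ih.1 ih.2
        fun j hj => Bool.not_eq_true _ ▸ hu j hj)

lemma tendsto_fullTwist_pow_zero {n : ℕ} (hn : 2 ≤ n) {a : Kq}
    (ha : val (q ^ ((n : ℤ) - 2) * a) ≤ 1) {f : W n}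
    (hf : f ∈ Module.End.eigenspace (Bop n) a) (u : Fin n → Bool) :
    Filter.Tendsto (fun m : ℕ => (fullTwist n ^ m) f u) Filter.atTop (nhds 0) := by
  obtain ⟨u₀, hu₀⟩ := Finite.exists_max (fun u => val (f u))
  refine tendsto_zero_of_val_le (N := val (f u₀)) fun m => ?_
  rw [fullTwist_eq_coxeter_pow, ← pow_mul]
  refine ((val_coxeter_pow_le hn ha hf hu₀ _).2 u).trans (mul_le_mul' ?_ le_rfl)
  exact pow_le_pow_of_le_one zero_le val_q_lt_one.le (Nat.le_mul_of_pos_left m (by omega))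

lemma fullTwist_pow_apply_of_eigenvector {n : ℕ} {a : Kq}
    (ha : val (q ^ ((n : ℤ) - 1) * a) = 1) {f : W n}
    (hf : f ∈ Module.End.eigenspace (Bop n) a) (m : ℕ) : (fullTwist n ^ m) f = f := by
  rw [fullTwist_eq_coxeter_pow, ← pow_mul, Module.End.pow_apply]
  exact Function.iterate_fixed (coxeter_apply_of_eigenvector ha hf) _

/-- Let `n ≥ 2` and let `P` be the projection of `W n = V^{⊗n}` onto
`E([n]) ⊕ E(-[n])` (the sum of the `B`-eigenspaces for `[n]` and `-[n]`) whose kernel is the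
sum of the `B`-eigenspaces for the eigenvalues `[n-2k]`, `0 < k < n` — the action of the type
`D` Jones–Wenzl projector `dₙ`.  Then the powers `R^m` of the image `R` of the type `D` full
twist converge to `P` as `m → ∞`, entrywise (on matrices taken with respect to the standard
basis) in the `q`-adic valuation topology of `𝕂`. -/
theorem stmt_19 (n : ℕ) (hn : 2 ≤ n) (P : Module.End Kq (W n))
    (hPfix : ∀ x ∈ Module.End.eigenspace (Bop n) (qint (n : ℤ)) ⊔
        Module.End.eigenspace (Bop n) (-(qint (n : ℤ))), P x = x)
    (hPker : ∀ k : ℕ, 0 < k → k < n →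
        ∀ x ∈ Module.End.eigenspace (Bop n) (qint ((n : ℤ) - 2 * k)), P x = 0) :
    Filter.Tendsto
      (fun m : ℕ =>
        LinearMap.toMatrix (Pi.basisFun Kq (Fin n → Bool)) (Pi.basisFun Kq (Fin n → Bool))
          ((fullTwist n) ^ m))
      Filter.atTop
      (nhds (LinearMap.toMatrix (Pi.basisFun Kq (Fin n → Bool))
        (Pi.basisFun Kq (Fin n → Bool)) P)) := by
  have key : ∀ (x : W n) (u : Fin n → Bool),
      Filter.Tendsto (fun m : ℕ => (fullTwist n ^ m) x u) Filter.atTop (nhds (P x u)) := by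
    intro x
    have hx : x ∈ ⨆ k : Fin (n + 1),
        Module.End.eigenspace (Bop n) (qint ((n : ℤ) - 2 * (k : ℕ))) := by
      rw [iSup_eigenspace_Bop]
      exact Submodule.mem_top
    induction hx using Submodule.iSup_induction' with
    | zero => simp
    | add x y _ _ hx hy =>
      intro u
      simp only [map_add, Pi.add_apply]
      exact (hx u).add (hy u)
    | mem k x hx =>
      intro u
      have hself := val_zpow_mul_qint_self hn
      rcases Nat.eq_zero_or_pos (k : ℕ) with h0 | hpos
      · rw [h0, Nat.cast_zero, mul_zero, sub_zero] at hx
        simp only [fullTwist_pow_apply_of_eigenvector hself hx,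
          hPfix x (Submodule.mem_sup_left hx)]
        exact tendsto_const_nhds
      · rcases (Nat.le_of_lt_succ k.isLt).eq_or_lt with hkn | hkn
        · rw [hkn, show (n : ℤ) - 2 * (n : ℕ) = -n by ring, qint_neg] at hx
          simp only [fullTwist_pow_apply_of_eigenvector
            (by rwa [mul_neg, Valuation.map_neg]) hx, hPfix x (Submodule.mem_sup_right hx)]
          exact tendsto_const_nhds
        · rw [hPker k hpos hkn x hx]
          exact tendsto_fullTwist_pow_zero hn (val_zpow_mul_qint_le_one hpos hkn) hx u
  refine tendsto_pi_nhds.mpr fun u => tendsto_pi_nhds.mpr fun w => ?_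
  simp only [LinearMap.toMatrix_apply, Pi.basisFun_apply, Pi.basisFun_repr]
  exact key _ u
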